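/- If A and A' are disjoint sets, A₁ ⊆ A with A₁ infinite, π a bijection of the ambient type swapping A₁ and A' (pointwise via some bijection A₁ ≃ A') and fixing everything else, then for the collection X = {B | B \ A is finite}: A₁ ∈ X but π⁻¹ '' A₁ ∉ X. Hence π does not preserve X under the induced action on sets of sets. -/

import Mathlib

/-- If `π` swaps an infinite `A₁ ⊆ A` with an infinite `A'` disjoint from `A`
(fixing everything else), then for `X = {B | B \ A finite}` we have `A₁ ∈ X`
but `π⁻¹ '' A₁ ∉ X`; hence `π` does not preserve `X`. -/
theorem swap_image_not_in_ideal {Ω : Type*} (A A₁ A' : Set Ω)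
    (h1A : A₁ ⊆ A) (h1inf : A₁.Infinite) (h'inf : A'.Infinite)
    (hdisj : Disjoint A' A)
    (e : ↥A₁ ≃ ↥A') (π : Equiv.Perm Ω)
    (hπ1 : ∀ a (h : a ∈ A₁), π a = ↑(e ⟨a, h⟩))
    (hπ2 : ∀ a (h : a ∈ A'), π a = ↑(e.symm ⟨a, h⟩))
    (hπ3 : ∀ a, a ∉ A₁ → a ∉ A' → π a = a) :
    A₁ ∈ {B : Set Ω | (B \ A).Finite} ∧
    (⇑π⁻¹ '' A₁) ∉ {B : Set Ω | (B \ A).Finite} ∧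
    (fun B => π '' B) '' {B : Set Ω | (B \ A).Finite} ≠
      {B : Set Ω | (B \ A).Finite} := by
  have himg : π '' A₁ = A' := by
    ext y
    constructor
    · rintro ⟨a, ha, rfl⟩
      rw [hπ1 a ha]
      exact (e ⟨a, ha⟩).2
    · intro hy
      exact ⟨e.symm ⟨y, hy⟩, (e.symm ⟨y, hy⟩).2, by simp [hπ1 _ (e.symm ⟨y, hy⟩).2]⟩
  have himg_inv : ⇑π⁻¹ '' A₁ = A' := by
    ext y
    constructor
    · rintro ⟨a, ha, rfl⟩
      have h : π (e ⟨a, ha⟩) = a := by simp [hπ2 _ (e ⟨a, ha⟩).2]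
      rw [Equiv.Perm.inv_eq_iff_eq.mpr h.symm]
      exact (e ⟨a, ha⟩).2
    · intro hy
      refine ⟨π y, ?_, by simp⟩
      rw [hπ2 y hy]
      exact (e.symm ⟨y, hy⟩).2
  have hA' : A' ∉ {B : Set Ω | (B \ A).Finite} := by
    rw [Set.mem_ofPred_eq, hdisj.sdiff_eq_left]
    exact h'inf
  have hA₁ : A₁ ∈ {B : Set Ω | (B \ A).Finite} := by
    simp [Set.sdiff_eq_empty.mpr h1A]
  refine ⟨hA₁, himg_inv ▸ hA', fun h => hA' ?_⟩
  rw [← h]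
  exact ⟨A₁, hA₁, himg⟩
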